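/- arXiv:1906.09489 — 4 statements merged into one kernel-verified Lean document; each statement's English description precedes it below -/
import Mathlib

section
/- Let Q_X, Q_W be invertible real d×d matrices, set Σ_X = Q_XᵀQ_X and Σ_W = Q_WᵀQ_W, and suppose Q_X Q_Wᵀ = U D Uᵀ where U is an orthogonal d×d matrix and D is a diagonal d×d matrix with strictly positive diagonal entries. Let A* := D^{1/2} Uᵀ Q_X^{-⊤}. Then A* is invertible, Tr((A*)ᵀA* Σ_X) · Tr((A*)⁻¹(A*)^{-⊤} Σ_W) = (Tr(D))², and for every invertible real d×d matrix B, Tr((A*)ᵀA* Σ_X) · Tr((A*)⁻¹(A*)^{-⊤} Σ_W) ≤ Tr(BᵀB Σ_X) · Tr(B⁻¹B^{-⊤} Σ_W). -/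
open Matrix

theorem trace_cs_aux {d : ℕ} (M N : Matrix (Fin d) (Fin d) ℝ) :
    (M * N).trace ^ 2 ≤ (N * Nᵀ).trace * (M * Mᵀ).trace := by
  have h := Finset.sum_mul_sq_le_sq_mul_sq (Finset.univ : Finset (Fin d × Fin d))
    (fun p => M p.1 p.2) (fun p => N p.2 p.1)
  have e1 : (M * N).trace = ∑ p : Fin d × Fin d, M p.1 p.2 * N p.2 p.1 := by
    simp [Matrix.trace, Matrix.mul_apply, Fintype.sum_prod_type]
  have e2 : (M * Mᵀ).trace = ∑ p : Fin d × Fin d, M p.1 p.2 ^ 2 := by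
    simp [Matrix.trace, Matrix.mul_apply, Fintype.sum_prod_type, sq]
  have e3 : (N * Nᵀ).trace = ∑ p : Fin d × Fin d, N p.2 p.1 ^ 2 := by
    rw [Fintype.sum_prod_type, Finset.sum_comm]
    simp [Matrix.trace, Matrix.mul_apply, sq]
  rw [e1, e2, e3, mul_comm]
  exact h

/-- With `Q_X, Q_W` invertible, `Σ_X = Q_XᵀQ_X`, `Σ_W = Q_WᵀQ_W`, and
`Q_X Q_Wᵀ = U D Uᵀ` (`U` orthogonal, `D` diagonal with strictly positive diagonal),
the matrix `A* = D^{1/2} Uᵀ Q_X^{-⊤}` is invertible, achieves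
`Tr((A*)ᵀA* Σ_X) · Tr((A*)⁻¹(A*)^{-⊤} Σ_W) = (Tr D)²`, and this value is minimal among
all invertible preprocessing matrices `B`. -/
theorem stmt_11 {d : ℕ} (QX QW : Matrix (Fin d) (Fin d) ℝ)
    (hQX : IsUnit QX.det) (hQW : IsUnit QW.det)
    (SigX SigW : Matrix (Fin d) (Fin d) ℝ)
    (hSigX : SigX = QXᵀ * QX) (hSigW : SigW = QWᵀ * QW)
    (U D : Matrix (Fin d) (Fin d) ℝ)
    (hU : Uᵀ * U = 1) (hDdiag : D.IsDiag) (hDpos : ∀ i, 0 < D i i)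
    (hUDU : QX * QWᵀ = U * D * Uᵀ)
    (Astar : Matrix (Fin d) (Fin d) ℝ)
    (hAstar : Astar = Matrix.diagonal (fun i => Real.sqrt (D i i)) * Uᵀ * (QX⁻¹)ᵀ) :
    IsUnit Astar.det ∧
      (Astarᵀ * Astar * SigX).trace * (Astar⁻¹ * (Astar⁻¹)ᵀ * SigW).trace = D.trace ^ 2 ∧
      ∀ B : Matrix (Fin d) (Fin d) ℝ, IsUnit B.det →
        (Astarᵀ * Astar * SigX).trace * (Astar⁻¹ * (Astar⁻¹)ᵀ * SigW).trace
          ≤ (Bᵀ * B * SigX).trace * (B⁻¹ * (B⁻¹)ᵀ * SigW).trace := by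
  set S := Matrix.diagonal (fun i => Real.sqrt (D i i)) with hS
  have hSS : S * S = D := by
    rw [hS, Matrix.diagonal_mul_diagonal]
    ext i j
    by_cases hij : i = j
    · subst hij
      simp [Real.mul_self_sqrt (hDpos i).le]
    · rw [Matrix.diagonal_apply_ne _ hij]
      exact (hDdiag hij).symm
  have hST : Sᵀ = S := by rw [hS, Matrix.diagonal_transpose]
  have hDT : Dᵀ = D := by rw [← hSS, Matrix.transpose_mul, hST]
  have hSdet : IsUnit S.det := by
    rw [hS, Matrix.det_diagonal, isUnit_iff_ne_zero]
    exact Finset.prod_ne_zero_iff.2 fun i _ => (Real.sqrt_pos.2 (hDpos i)).ne'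
  have hUdet : IsUnit Uᵀ.det := by
    have := congrArg Matrix.det hU
    rw [Matrix.det_mul, Matrix.det_one] at this
    exact IsUnit.of_mul_eq_one _ this
  have hXi : (QX⁻¹)ᵀ * QXᵀ = 1 := by
    rw [← Matrix.transpose_mul, Matrix.mul_nonsing_inv _ hQX, Matrix.transpose_one]
  have hXi' : QXᵀ * (QX⁻¹)ᵀ = 1 := by
    rw [← Matrix.transpose_mul, Matrix.nonsing_inv_mul _ hQX, Matrix.transpose_one]
  have hXdet : IsUnit ((QX⁻¹)ᵀ).det := by
    have := congrArg Matrix.det hXi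
    rw [Matrix.det_mul, Matrix.det_one] at this
    exact IsUnit.of_mul_eq_one _ this
  have hAdet : IsUnit Astar.det := by
    rw [hAstar, Matrix.det_mul, Matrix.det_mul]
    exact (hSdet.mul hUdet).mul hXdet
  have hWX : QW * QXᵀ = U * D * Uᵀ := by
    have := congrArg Matrix.transpose hUDU
    simpa [Matrix.transpose_mul, hDT, Matrix.mul_assoc] using this
  have hAX : Astar * QXᵀ = S * Uᵀ := by
    rw [hAstar, Matrix.mul_assoc, hXi, Matrix.mul_one]
  have hUSA : U * S * Astar = QW := by
    calc U * S * Astar = U * (S * S) * Uᵀ * (QX⁻¹)ᵀ := by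
          rw [hAstar]; simp only [Matrix.mul_assoc]
      _ = QW := by rw [hSS, ← hWX, Matrix.mul_assoc, hXi', Matrix.mul_one]
  have hWA : QW * Astar⁻¹ = U * S := by
    rw [← hUSA, Matrix.mul_assoc, Matrix.mul_nonsing_inv _ hAdet, Matrix.mul_one]
  have t1 : ∀ B : Matrix (Fin d) (Fin d) ℝ,
      (Bᵀ * B * SigX).trace = ((B * QXᵀ) * (B * QXᵀ)ᵀ).trace := by
    intro B
    rw [hSigX, Matrix.mul_assoc, Matrix.trace_mul_comm]
    simp only [Matrix.transpose_mul, Matrix.transpose_transpose, Matrix.mul_assoc]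
  have t2 : ∀ C : Matrix (Fin d) (Fin d) ℝ,
      (C * Cᵀ * SigW).trace = ((QW * C) * (QW * C)ᵀ).trace := by
    intro C
    rw [hSigW, ← Matrix.mul_assoc, Matrix.trace_mul_comm]
    simp only [Matrix.transpose_mul, Matrix.mul_assoc]
  have hval : (Astarᵀ * Astar * SigX).trace * (Astar⁻¹ * (Astar⁻¹)ᵀ * SigW).trace
      = D.trace ^ 2 := by
    have a1 : (S * Uᵀ) * (S * Uᵀ)ᵀ = D := by
      rw [Matrix.transpose_mul, Matrix.transpose_transpose, hST, Matrix.mul_assoc,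
        ← Matrix.mul_assoc Uᵀ, hU, Matrix.one_mul, hSS]
    have a2 : ((U * S) * (U * S)ᵀ).trace = D.trace := by
      rw [Matrix.trace_mul_comm, Matrix.transpose_mul, hST, Matrix.mul_assoc,
        ← Matrix.mul_assoc Uᵀ, hU, Matrix.one_mul, hSS]
    rw [t1, t2, hAX, hWA, a1, a2, sq]
  refine ⟨hAdet, hval, ?_⟩
  intro B hB
  rw [hval, t1, t2]
  have h := trace_cs_aux (QW * B⁻¹) (B * QXᵀ)
  have e : (QW * B⁻¹) * (B * QXᵀ) = U * D * Uᵀ := by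
    rw [Matrix.mul_assoc, ← Matrix.mul_assoc B⁻¹, Matrix.nonsing_inv_mul _ hB, Matrix.one_mul, hWX]
  have e' : (U * D * Uᵀ).trace = D.trace := by
    rw [Matrix.trace_mul_comm, ← Matrix.mul_assoc, hU, Matrix.one_mul]
  rwa [e, e'] at h
end

section
/- Let Q_X, Q_W be invertible real d×d matrices, set Σ_X = Q_XᵀQ_X and Σ_W = Q_WᵀQ_W, and suppose Q_X Q_Wᵀ = U D Vᵀ where U and V are orthogonal d×d matrices and D is a diagonal d×d matrix with strictly positive diagonal entries. Then A := D^{1/2} Uᵀ Q_X^{-⊤} is invertible and satisfies A Σ_X Aᵀ = D = A^{-⊤} Σ_W A⁻¹; in particular A Σ_X Aᵀ = A^{-⊤} Σ_W A⁻¹. -/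
open Matrix

/-- With `Q_X, Q_W` invertible, `Σ_X = Q_XᵀQ_X`, `Σ_W = Q_WᵀQ_W`, and
`Q_X Q_Wᵀ = U D Vᵀ` (`U, V` orthogonal, `D` diagonal with strictly positive diagonal),
the matrix `A = D^{1/2} Uᵀ Q_X^{-⊤}` is invertible and satisfies
`A Σ_X Aᵀ = D = A^{-⊤} Σ_W A⁻¹`. -/
theorem stmt_13 {d : ℕ} (QX QW : Matrix (Fin d) (Fin d) ℝ)
    (hQX : IsUnit QX.det) (hQW : IsUnit QW.det)
    (SigX SigW : Matrix (Fin d) (Fin d) ℝ)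
    (hSigX : SigX = QXᵀ * QX) (hSigW : SigW = QWᵀ * QW)
    (U V D : Matrix (Fin d) (Fin d) ℝ)
    (hU : Uᵀ * U = 1) (hV : Vᵀ * V = 1)
    (hDdiag : D.IsDiag) (hDpos : ∀ i, 0 < D i i)
    (hUDV : QX * QWᵀ = U * D * Vᵀ)
    (A : Matrix (Fin d) (Fin d) ℝ)
    (hA : A = Matrix.diagonal (fun i => Real.sqrt (D i i)) * Uᵀ * (QX⁻¹)ᵀ) :
    IsUnit A.det ∧ A * SigX * Aᵀ = D ∧ (A⁻¹)ᵀ * SigW * A⁻¹ = D := by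
  obtain ⟨S, hS⟩ : ∃ S, S = Matrix.diagonal (fun i => Real.sqrt (D i i)) := ⟨_, rfl⟩
  obtain ⟨T, hT⟩ : ∃ T, T = Matrix.diagonal (fun i => (Real.sqrt (D i i))⁻¹) := ⟨_, rfl⟩
  have hD : D = Matrix.diagonal (fun i => D i i) := hDdiag.diagonal_diag.symm
  have hne : ∀ i, Real.sqrt (D i i) ≠ 0 := fun i => (Real.sqrt_pos.2 (hDpos i)).ne'
  have hSS : S * S = D := by
    rw [hS, Matrix.diagonal_mul_diagonal]
    conv_rhs => rw [hD]
    congr 1; funext i; exact Real.mul_self_sqrt (hDpos i).le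
  have hST : S * T = 1 := by
    rw [hS, hT, Matrix.diagonal_mul_diagonal, ← Matrix.diagonal_one]
    congr 1; funext i; exact mul_inv_cancel₀ (hne i)
  have hTS : T * S = 1 := mul_eq_one_comm.1 hST
  have hSt : Sᵀ = S := by rw [hS, Matrix.diagonal_transpose]
  have hTt : Tᵀ = T := by rw [hT, Matrix.diagonal_transpose]
  have hDt : Dᵀ = D := by rw [← hSS, Matrix.transpose_mul, hSt]
  have hP : QX * QX⁻¹ = 1 := Matrix.mul_nonsing_inv _ hQX
  have hPt : (QX⁻¹)ᵀ * QXᵀ = 1 := by rw [← Matrix.transpose_mul, hP, Matrix.transpose_one]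
  rw [← hS] at hA
  have hAB : A * (QXᵀ * U * T) = 1 := by
    calc A * (QXᵀ * U * T) = S * (Uᵀ * (((QX⁻¹)ᵀ * QXᵀ) * U)) * T := by
          rw [hA]; simp only [Matrix.mul_assoc]
      _ = 1 := by rw [hPt, Matrix.one_mul, hU, Matrix.mul_one, hST]
  have hinv : A⁻¹ = QXᵀ * U * T := Matrix.inv_eq_right_inv hAB
  have hUDVt : QW * QXᵀ = V * D * Uᵀ := by
    have h := congrArg Matrix.transpose hUDV
    simpa [Matrix.transpose_mul, hDt, Matrix.mul_assoc] using h
  refine ⟨Matrix.isUnit_det_of_right_inverse hAB, ?_, ?_⟩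
  · calc A * SigX * Aᵀ = S * (Uᵀ * (((QX⁻¹)ᵀ * QXᵀ) * ((QX * QX⁻¹) * U))) * S := by
          rw [hA, hSigX]
          simp only [Matrix.transpose_mul, Matrix.transpose_transpose, hSt, Matrix.mul_assoc]
      _ = D := by rw [hPt, hP, Matrix.one_mul, Matrix.one_mul, hU, Matrix.mul_one, hSS]
  · calc (A⁻¹)ᵀ * SigW * A⁻¹ = T * Uᵀ * (QX * QWᵀ) * (QW * QXᵀ) * U * T := by
          rw [hinv, hSigW]
          simp only [Matrix.transpose_mul, Matrix.transpose_transpose, hTt, Matrix.mul_assoc]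
      _ = T * ((Uᵀ * U) * (D * ((Vᵀ * V) * (D * ((Uᵀ * U) * T))))) := by
          rw [hUDV, hUDVt]; simp only [Matrix.mul_assoc]
      _ = (T * S) * (S * S) * (S * T) := by
          rw [hU, hV]; simp only [Matrix.one_mul, ← hSS, Matrix.mul_assoc]
      _ = D := by rw [hTS, hST, hSS, Matrix.one_mul, Matrix.mul_one]
end

section
/- Let Σ_X, Σ_W be real d×d matrices whose diagonal entries are all strictly positive, let d_X, d_W ∈ ℝ^d be the vectors with d_X(i) = √((Σ_X)_{ii}) and d_W(i) = √((Σ_W)_{ii}), and let Â be the diagonal d×d matrix with Â_{ii} = d_X(i)^{-1/2} d_W(i)^{1/2}. Then Â is invertible, Tr(ÂᵀÂ Σ_X) · Tr(Â⁻¹Â^{-⊤} Σ_W) = ⟨d_X, d_W⟩², and Tr(Σ_X) · Tr(Σ_W) = ‖d_X‖²‖d_W‖². -/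
open Matrix

/-- For `Σ_X, Σ_W` with strictly positive diagonal entries, with
`d_X(i) = √((Σ_X)ᵢᵢ)`, `d_W(i) = √((Σ_W)ᵢᵢ)` and `Â = diag(d_X(i)^{-1/2} d_W(i)^{1/2})`:
`Â` is invertible, `Tr(ÂᵀÂ Σ_X) · Tr(Â⁻¹Â^{-⊤} Σ_W) = ⟪d_X, d_W⟫²`, and
`Tr(Σ_X) · Tr(Σ_W) = ‖d_X‖²‖d_W‖²`. -/
theorem stmt_15 {d : ℕ} (SigX SigW : Matrix (Fin d) (Fin d) ℝ)
    (hX : ∀ i, 0 < SigX i i) (hW : ∀ i, 0 < SigW i i)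
    (dX dW : Fin d → ℝ)
    (hdX : ∀ i, dX i = Real.sqrt (SigX i i)) (hdW : ∀ i, dW i = Real.sqrt (SigW i i))
    (Ahat : Matrix (Fin d) (Fin d) ℝ)
    (hAhat : Ahat = Matrix.diagonal fun i => Real.sqrt (dW i) / Real.sqrt (dX i)) :
    IsUnit Ahat.det ∧
      (Ahatᵀ * Ahat * SigX).trace * (Ahat⁻¹ * (Ahat⁻¹)ᵀ * SigW).trace = (dX ⬝ᵥ dW) ^ 2 ∧
      SigX.trace * SigW.trace = (dX ⬝ᵥ dX) * (dW ⬝ᵥ dW) := by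
  have pX : ∀ i, 0 < dX i := fun i => by rw [hdX]; exact Real.sqrt_pos.2 (hX i)
  have pW : ∀ i, 0 < dW i := fun i => by rw [hdW]; exact Real.sqrt_pos.2 (hW i)
  have sX : ∀ i, SigX i i = dX i * dX i := fun i => by
    rw [hdX]; exact (Real.mul_self_sqrt (hX i).le).symm
  have sW : ∀ i, SigW i i = dW i * dW i := fun i => by
    rw [hdW]; exact (Real.mul_self_sqrt (hW i).le).symm
  have qX : ∀ i, Real.sqrt (dX i) ≠ 0 := fun i => (Real.sqrt_pos.2 (pX i)).ne'
  have qW : ∀ i, Real.sqrt (dW i) ≠ 0 := fun i => (Real.sqrt_pos.2 (pW i)).ne'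
  have hinv : Ahat⁻¹ = Matrix.diagonal fun i => Real.sqrt (dX i) / Real.sqrt (dW i) := by
    apply Matrix.inv_eq_right_inv
    rw [hAhat, Matrix.diagonal_mul_diagonal, ← Matrix.diagonal_one]
    congr 1
    funext i
    have := qX i
    have := qW i
    field_simp
  refine ⟨?_, ?_, ?_⟩
  · rw [hAhat, Matrix.det_diagonal, isUnit_iff_ne_zero]
    exact Finset.prod_ne_zero_iff.2 fun i _ => div_ne_zero (qW i) (qX i)
  · have e1 : (Ahatᵀ * Ahat * SigX).trace = dX ⬝ᵥ dW := by
      rw [hAhat, Matrix.diagonal_transpose, Matrix.diagonal_mul_diagonal]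
      simp only [Matrix.trace, Matrix.diag_apply, Matrix.diagonal_mul, dotProduct]
      refine Finset.sum_congr rfl fun i _ => ?_
      rw [sX, div_mul_div_comm, Real.mul_self_sqrt (pX i).le, Real.mul_self_sqrt (pW i).le]
      have := (pX i).ne'
      field_simp
    have e2 : (Ahat⁻¹ * (Ahat⁻¹)ᵀ * SigW).trace = dX ⬝ᵥ dW := by
      rw [hinv, Matrix.diagonal_transpose, Matrix.diagonal_mul_diagonal]
      simp only [Matrix.trace, Matrix.diag_apply, Matrix.diagonal_mul, dotProduct]
      refine Finset.sum_congr rfl fun i _ => ?_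
      rw [sW, div_mul_div_comm, Real.mul_self_sqrt (pX i).le, Real.mul_self_sqrt (pW i).le]
      have := (pW i).ne'
      field_simp
    rw [e1, e2, sq]
  · simp only [Matrix.trace, Matrix.diag_apply, dotProduct, sX, sW]
end

section
/- Let Σ_X, Σ_W be real d×d matrices whose diagonal entries are all nonnegative, and let d_X, d_W ∈ ℝ^d be the vectors with d_X(i) = √((Σ_X)_{ii}) and d_W(i) = √((Σ_W)_{ii}). Then for every invertible diagonal real d×d matrix A, ⟨d_X, d_W⟩² ≤ Tr(AᵀA Σ_X) · Tr(A⁻¹A^{-⊤} Σ_W); that is, among diagonal preprocessing matrices the value ⟨d_X, d_W⟩² is a lower bound on the variance proxy Tr(AᵀAΣ_X)·Tr(A⁻¹A^{-⊤}Σ_W). -/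
open Matrix

/-- For `Σ_X, Σ_W` with nonnegative diagonal entries, with
`d_X(i) = √((Σ_X)ᵢᵢ)` and `d_W(i) = √((Σ_W)ᵢᵢ)`, every invertible diagonal matrix `A`
satisfies `⟪d_X, d_W⟫² ≤ Tr(AᵀA Σ_X) · Tr(A⁻¹A^{-⊤} Σ_W)`. -/
theorem stmt_16 {d : ℕ} (SigX SigW : Matrix (Fin d) (Fin d) ℝ)
    (hX : ∀ i, 0 ≤ SigX i i) (hW : ∀ i, 0 ≤ SigW i i)
    (dX dW : Fin d → ℝ)
    (hdX : ∀ i, dX i = Real.sqrt (SigX i i)) (hdW : ∀ i, dW i = Real.sqrt (SigW i i))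
    (A : Matrix (Fin d) (Fin d) ℝ) (hdiag : A.IsDiag) (hA : IsUnit A.det) :
    (dX ⬝ᵥ dW) ^ 2 ≤ (Aᵀ * A * SigX).trace * (A⁻¹ * (A⁻¹)ᵀ * SigW).trace := by
  obtain ⟨a, rfl⟩ : ∃ a : Fin d → ℝ, A = diagonal a := ⟨A.diag, hdiag.diagonal_diag.symm⟩
  have ha : ∀ i, a i ≠ 0 := by
    intro i
    have h := hA.ne_zero
    rw [det_diagonal] at h
    exact Finset.prod_ne_zero_iff.mp h i (Finset.mem_univ i)
  have hinv : (diagonal a)⁻¹ = diagonal (fun i => (a i)⁻¹) := by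
    apply inv_eq_right_inv
    rw [diagonal_mul_diagonal, ← diagonal_one]
    congr 1
    funext i
    exact mul_inv_cancel₀ (ha i)
  have h1 : ((diagonal a)ᵀ * diagonal a * SigX).trace = ∑ i, (a i * dX i) ^ 2 := by
    rw [diagonal_transpose, diagonal_mul_diagonal, trace]
    refine Finset.sum_congr rfl fun i _ => ?_
    rw [diag_apply, diagonal_mul, mul_pow, hdX, Real.sq_sqrt (hX i)]
    ring
  have h2 : ((diagonal a)⁻¹ * ((diagonal a)⁻¹)ᵀ * SigW).trace
      = ∑ i, ((a i)⁻¹ * dW i) ^ 2 := by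
    rw [hinv, diagonal_transpose, diagonal_mul_diagonal, trace]
    refine Finset.sum_congr rfl fun i _ => ?_
    rw [diag_apply, diagonal_mul, mul_pow, hdW, Real.sq_sqrt (hW i)]
    ring
  have h3 : dX ⬝ᵥ dW = ∑ i, (a i * dX i) * ((a i)⁻¹ * dW i) := by
    rw [dotProduct]
    refine Finset.sum_congr rfl fun i _ => ?_
    have := ha i
    field_simp
  rw [h1, h2, h3]
  exact Finset.sum_mul_sq_le_sq_mul_sq _ _ _
end
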